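/- Let h and n be positive integers with n > h and n+h even, and let k_1 ≤ k_2 ≤ … ≤ k_n be integers. Then the sum, over all integer tuples (l_1,…,l_{n−1}) with k_i ≤ l_i ≤ k_{i+1}−1 for each 1 ≤ i ≤ n−1, of the Pfaffian of the order n+h−2 upper triangular array with entries B_{i,j} = gt_{h−1}(l_i,l_j) for 1 ≤ i < j ≤ n−1, B_{i,n−1+j} = binom(l_i, h−1−j) for 1 ≤ i ≤ n−1 and 1 ≤ j ≤ h−1, and B_{n−1+i,n−1+j} = 0 for 1 ≤ i < j ≤ h−1, equals the Pfaffian of the order n+h upper triangular array with entries C_{i,j} = gt_h(k_i,k_j) for 1 ≤ i < j ≤ n, C_{i,n+j} = binom(k_i, h−j) for 1 ≤ i ≤ n and 1 ≤ j ≤ h, and C_{n+i,n+j} = 0 for 1 ≤ i < j ≤ h. -/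

import Mathlib

open MvPolynomial

noncomputable section

/-- The generalized binomial coefficient `binom(x,m) = x(x-1)⋯(x-m+1)/m!`. -/
def qbinom (x : ℚ) (m : ℕ) : ℚ := (∏ j ∈ Finset.range m, (x - j)) / m.factorial

/-- `gtChar gt` says that `gt h` is the (unique) bivariate polynomial `gt_h(x,y)`. -/
def gtChar (gt : ℕ → MvPolynomial (Fin 2) ℚ) : Prop :=
  gt 0 = 1 ∧
    ∀ h : ℕ, 1 ≤ h → ∀ x y : ℤ, (h : ℤ) ≤ x →
      MvPolynomial.eval ![(x : ℚ), (y : ℚ)] (gt h) =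
        ∑ p ∈ Finset.Icc (h : ℤ) (x - 1),
          (qbinom ((x : ℚ) - (p : ℚ) + (h : ℚ) - 1) h * qbinom ((y : ℚ) - (p : ℚ) + (h : ℚ) - 2) h -
            qbinom ((x : ℚ) - (p : ℚ) + (h : ℚ) - 2) h * qbinom ((y : ℚ) - (p : ℚ) + (h : ℚ) - 1) h)

/-- Skew-symmetric extension of an upper triangular array. -/
def skewExt {R : Type*} [Ring R] {N : ℕ} (A : Fin N → Fin N → R) : Fin N → Fin N → R :=
  fun i j => if i < j then A i j else if j < i then -A j i else 0

/-- The Pfaffian of an upper triangular array of (even) order `N`. -/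
def pfUpper {R : Type*} [CommRing R] [Algebra ℚ R] (N : ℕ) (A : Fin N → Fin N → R) : R :=
  ((2 ^ (N / 2) * (N / 2).factorial : ℚ)⁻¹) •
    ∑ σ : Equiv.Perm (Fin N),
      (Equiv.Perm.sign σ : ℤ) •
        ∏ i : Fin (N / 2),
          skewExt A (σ ⟨2 * i.val, by have := i.isLt; omega⟩)
            (σ ⟨2 * i.val + 1, by have := i.isLt; omega⟩)

section Pfaffian

open Finset Equiv

/-- The signed sum over permutations of `Fin (2 * m)` that is `2 ^ m * m!` times the Pfaffian of
the skew-symmetric array `a`. -/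
def pfSum (m : ℕ) (a : ℕ → ℕ → ℚ) : ℚ :=
  ∑ σ : Perm (Fin (2 * m)), ((Perm.sign σ : ℤ) : ℚ) *
    ∏ i : Fin m, a (σ ⟨2 * i.val, by omega⟩).val (σ ⟨2 * i.val + 1, by omega⟩).val

theorem pfSum_congr {m : ℕ} {a b : ℕ → ℕ → ℚ}
    (hab : ∀ i < 2 * m, ∀ j < 2 * m, a i j = b i j) : pfSum m a = pfSum m b := by
  unfold pfSum
  refine sum_congr rfl fun σ _ => ?_
  congr 1
  exact prod_congr rfl fun i _ => hab _ (Fin.isLt _) _ (Fin.isLt _)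

theorem pfUpper_eq_pfSum {N m : ℕ} (hN : N = 2 * m) (A : Fin N → Fin N → ℚ) (a : ℕ → ℕ → ℚ)
    (skew : ∀ i j, a j i = -a i j) (hA : ∀ i j : Fin N, i < j → A i j = a i j) :
    pfUpper N A = (2 ^ m * m.factorial : ℚ)⁻¹ * pfSum m a := by
  obtain rfl : m = N / 2 := by omega
  have hext : ∀ i j : Fin N, skewExt A i j = a i j := by
    intro i j
    unfold skewExt
    split_ifs with h1 h2
    · exact hA i j h1
    · rw [hA j i h2, skew, neg_neg]
    · have hij : i = j := by omega
      have := skew i j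
      subst hij
      linarith
  unfold pfUpper pfSum
  rw [smul_eq_mul]
  congr 1
  have key : ∀ (M : ℕ) (hM : N = M) (hlt : ∀ i : Fin (N / 2), 2 * i.val + 1 < M),
      (∑ σ : Perm (Fin N), (Perm.sign σ : ℤ) • ∏ i : Fin (N / 2),
          skewExt A (σ ⟨2 * i.val, by have := i.isLt; omega⟩)
            (σ ⟨2 * i.val + 1, by have := i.isLt; omega⟩)) =
        ∑ σ : Perm (Fin M), ((Perm.sign σ : ℤ) : ℚ) * ∏ i : Fin (N / 2),
          a (σ ⟨2 * i.val, by have := hlt i; omega⟩).val (σ ⟨2 * i.val + 1, hlt i⟩).val := by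
    rintro M rfl hlt
    simp only [hext, zsmul_eq_mul]
  exact key _ hN _

/-- Distributing a product of double sums over pairs of consecutive positions. -/
theorem prod_pair_sum {α : Type*} {m : ℕ} (s : Fin (2 * m) → Finset α) (F : Fin m → α → α → ℚ) :
    ∏ i : Fin m, ∑ x ∈ s ⟨2 * i.val, by omega⟩, ∑ y ∈ s ⟨2 * i.val + 1, by omega⟩, F i x y =
      ∑ f ∈ Fintype.piFinset s,
        ∏ i : Fin m, F i (f ⟨2 * i.val, by omega⟩) (f ⟨2 * i.val + 1, by omega⟩) := by
  simp only [← Finset.sum_product']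
  rw [prod_univ_sum]
  refine sum_nbij'
    (fun g j => if j.val % 2 = 0 then (g ⟨j.val / 2, by omega⟩).1 else (g ⟨j.val / 2, by omega⟩).2)
    (fun f i => (f ⟨2 * i.val, by omega⟩, f ⟨2 * i.val + 1, by omega⟩)) ?_ ?_ ?_ ?_ ?_
  · intro g hg
    simp only [Fintype.mem_piFinset, mem_product] at hg ⊢
    intro j
    have := hg ⟨j.val / 2, by omega⟩
    split_ifs with hj
    · convert this.1 using 2
      ext; simp; omega
    · convert this.2 using 2
      ext; simp; omega
  · intro f hf
    simp only [Fintype.mem_piFinset, mem_product] at hf ⊢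
    exact fun i => ⟨hf _, hf _⟩
  · intro g _
    funext i
    ext
    · simp
    · have h2 : (2 * i.val + 1) / 2 = i.val := by omega
      simp [h2, Nat.add_mod]
  · intro f _
    funext j
    dsimp only
    split_ifs with hj <;> congr 1 <;> ext <;> simp <;> omega
  · intro g _
    refine prod_congr rfl fun i _ => ?_
    have h2 : (2 * i.val + 1) / 2 = i.val := by omega
    simp [h2, Nat.add_mod]

theorem sum_piFinset_comp_perm {α β : Type*} [AddCommMonoid β] {N : ℕ} (s : Fin N → Finset α)
    (σ : Perm (Fin N)) (G : (Fin N → α) → β) :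
    ∑ f ∈ Fintype.piFinset (fun i => s (σ i)), G f =
      ∑ L ∈ Fintype.piFinset s, G (fun i => L (σ i)) := by
  refine sum_nbij' (fun f i => f (σ.symm i)) (fun L i => L (σ i)) ?_ ?_ ?_ ?_ ?_
  · intro f hf
    simp only [Fintype.mem_piFinset] at hf ⊢
    intro i
    simpa using hf (σ.symm i)
  · intro L hL
    simp only [Fintype.mem_piFinset] at hL ⊢
    exact fun i => hL _
  all_goals intro f _; simp

/-- The Pfaffian sum is additive in each index, so it commutes with summing over
one variable per index. -/
theorem sum_pfSum {α : Type*} {m : ℕ} (s : ℕ → Finset α) (β : ℕ → ℕ → α → α → ℚ)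
    (B : (Fin (2 * m) → α) → ℕ → ℕ → ℚ)
    (hB : ∀ L, ∀ i j : Fin (2 * m), B L i j = β i j (L i) (L j)) :
    ∑ L ∈ Fintype.piFinset (fun i : Fin (2 * m) => s i), pfSum m (B L) =
      pfSum m (fun i j => ∑ x ∈ s i, ∑ y ∈ s j, β i j x y) := by
  unfold pfSum
  rw [sum_comm]
  refine sum_congr rfl fun σ _ => ?_
  rw [← mul_sum]
  congr 1
  rw [prod_pair_sum (fun i => s (σ i))
    (fun i => β (σ ⟨2 * i.val, by omega⟩) (σ ⟨2 * i.val + 1, by omega⟩)),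
    sum_piFinset_comp_perm (fun i => s i) σ]
  exact sum_congr rfl fun L _ => prod_congr rfl fun i _ => hB _ _ _

theorem pfSum_conj {m : ℕ} (M : Matrix (Fin (2 * m)) (Fin (2 * m)) ℚ) (a b : ℕ → ℕ → ℚ)
    (hb : ∀ i j : Fin (2 * m), b i j = ∑ p, ∑ q, M i p * M j q * a p q) :
    pfSum m b = M.det * pfSum m a := by
  unfold pfSum
  have h1 : ∀ σ : Perm (Fin (2 * m)),
      ∏ i : Fin m, b (σ ⟨2 * i.val, by omega⟩) (σ ⟨2 * i.val + 1, by omega⟩) =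
      ∑ f : Fin (2 * m) → Fin (2 * m), (∏ j, M (σ j) (f j)) *
        ∏ i : Fin m, a (f ⟨2 * i.val, by omega⟩) (f ⟨2 * i.val + 1, by omega⟩) := by
    intro σ
    simp only [hb]
    rw [prod_pair_sum (fun _ => univ) (fun i p q => M (σ ⟨2 * i.val, by omega⟩) p *
      M (σ ⟨2 * i.val + 1, by omega⟩) q * a p q), Fintype.piFinset_univ]
    refine sum_congr rfl fun f _ => ?_
    rw [prod_mul_distrib]
    congr 1
    let e := finProdFinEquiv.trans (finCongr (Nat.mul_comm m 2))
    have e0 : ∀ i : Fin m, e (i, 0) = ⟨2 * i.val, by omega⟩ := fun i => Fin.ext (by simp [e])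
    have e1 : ∀ i : Fin m, e (i, 1) = ⟨2 * i.val + 1, by omega⟩ := fun i =>
      Fin.ext (by simp [e]; omega)
    rw [← Equiv.prod_comp e, Fintype.prod_prod_type]
    simp only [Fin.prod_univ_two, e0, e1]
  simp only [h1, mul_sum]
  rw [sum_comm]
  have h2 : ∀ f : Fin (2 * m) → Fin (2 * m),
      ∑ σ : Perm (Fin (2 * m)), ((Perm.sign σ : ℤ) : ℚ) * ((∏ j, M (σ j) (f j)) *
        ∏ i : Fin m, a (f ⟨2 * i.val, by omega⟩) (f ⟨2 * i.val + 1, by omega⟩)) =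
      (M.submatrix id f).det *
        ∏ i : Fin m, a (f ⟨2 * i.val, by omega⟩) (f ⟨2 * i.val + 1, by omega⟩) := by
    intro f
    rw [Matrix.det_apply', sum_mul]
    refine sum_congr rfl fun σ _ => ?_
    simp [mul_assoc]
  simp only [h2]
  rw [← sum_subset (subset_univ (univ.image fun σ : Perm (Fin (2 * m)) => (σ : Fin _ → Fin _)))]
  · rw [sum_image (fun σ _ τ _ h => DFunLike.coe_injective h)]
    refine sum_congr rfl fun σ _ => ?_
    rw [Matrix.det_permute']
    ring
  · intro f _ hf
    have hni : ¬ Function.Injective f := by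
      intro hi
      apply hf
      rw [mem_image]
      exact ⟨Equiv.ofBijective f (Finite.injective_iff_bijective.1 hi), mem_univ _, rfl⟩
    simp only [Function.Injective, not_forall] at hni
    obtain ⟨i, j, hij, hne⟩ := hni
    rw [Matrix.det_zero_of_column_eq hne (by intro x; simp [hij]), zero_mul]

theorem pfSum_perm {m : ℕ} (τ : Perm (Fin (2 * m))) (a b : ℕ → ℕ → ℚ)
    (hb : ∀ i j : Fin (2 * m), b i j = a (τ i) (τ j)) :
    pfSum m b = ((Perm.sign τ : ℤ) : ℚ) * pfSum m a := by
  unfold pfSum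
  rw [mul_sum]
  refine Fintype.sum_equiv (Equiv.mulLeft τ) _ _ fun σ => ?_
  have hs : ((Perm.sign τ : ℤ) : ℚ) * ((Perm.sign τ : ℤ) : ℚ) = 1 := by
    rw [← Int.cast_mul, Int.units_coe_mul_self, Int.cast_one]
  simp only [hb, Equiv.coe_mulLeft, Perm.sign_mul, Units.val_mul, Int.cast_mul, Perm.mul_apply]
  rw [← mul_assoc, ← mul_assoc, hs, one_mul]

/-- A sum over permutations fixing `0` is a sum over permutations of the successors. -/
theorem sum_perm_fix_zero {k : ℕ} (F : Perm (Fin (k + 1)) → ℚ) :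
    ∑ σ : Perm (Fin (k + 1)), (if (σ ⟨0, by omega⟩).val = 0 then F σ else 0) =
      ∑ e : Perm (Fin k), F (Perm.decomposeFin.symm (0, e)) := by
  rw [← Equiv.sum_comp Perm.decomposeFin.symm, Fintype.sum_prod_type, sum_comm]
  refine sum_congr rfl fun e _ => ?_
  have : ∀ (p : Fin (k + 1)) hlt, (Perm.decomposeFin.symm (p, e) : Perm (Fin (k + 1))) ⟨0, hlt⟩ = p :=
    fun p _ => Perm.decomposeFin_symm_apply_zero p e
  simp only [this, Fin.val_eq_zero_iff, sum_ite_eq', mem_univ, if_true]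

/-- The term of `pfSum` at a permutation. -/
def pfTerm (m : ℕ) (a : ℕ → ℕ → ℚ) (σ : Perm (Fin (2 * m))) : ℚ :=
  ((Perm.sign σ : ℤ) : ℚ) *
    ∏ i : Fin m, a (σ ⟨2 * i.val, by omega⟩).val (σ ⟨2 * i.val + 1, by omega⟩).val

theorem pfTerm_mul_swap_within {m : ℕ} {a : ℕ → ℕ → ℚ} (skew : ∀ i j, a j i = -a i j)
    (σ : Perm (Fin (2 * m))) (i : Fin m) :
    pfTerm m a (σ * swap ⟨2 * i.val, by omega⟩ ⟨2 * i.val + 1, by omega⟩) = pfTerm m a σ := by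
  unfold pfTerm
  rw [Perm.sign_mul, Perm.sign_swap (by simp)]
  have : ∀ j : Fin m,
      a ((σ * swap (⟨2 * i.val, by omega⟩ : Fin (2 * m)) ⟨2 * i.val + 1, by omega⟩)
          ⟨2 * j.val, by omega⟩).val
        ((σ * swap (⟨2 * i.val, by omega⟩ : Fin (2 * m)) ⟨2 * i.val + 1, by omega⟩)
          ⟨2 * j.val + 1, by omega⟩).val =
      (if j = i then -1 else 1) *
        a (σ ⟨2 * j.val, by omega⟩).val (σ ⟨2 * j.val + 1, by omega⟩).val := by
    intro j
    by_cases hj : j = i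
    · subst hj
      simp [skew (σ ⟨2 * j.val, by omega⟩).val (σ ⟨2 * j.val + 1, by omega⟩).val]
    · have hj' : j.val ≠ i.val := fun h => hj (Fin.ext h)
      rw [Perm.mul_apply, Perm.mul_apply, swap_apply_of_ne_of_ne, swap_apply_of_ne_of_ne]
      · simp [hj]
      all_goals simp only [ne_eq, Fin.mk.injEq]; omega
  simp only [this, prod_mul_distrib, prod_ite_eq', mem_univ, if_true]
  simp

theorem pfTerm_mul_swap_pairs {m : ℕ} {a : ℕ → ℕ → ℚ} (σ : Perm (Fin (2 * m))) {i j : Fin m}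
    (hij : i ≠ j) :
    pfTerm m a (σ * (swap ⟨2 * i.val, by omega⟩ ⟨2 * j.val, by omega⟩ *
      swap ⟨2 * i.val + 1, by omega⟩ ⟨2 * j.val + 1, by omega⟩)) = pfTerm m a σ := by
  have hij' : i.val ≠ j.val := fun h => hij (Fin.ext h)
  unfold pfTerm
  rw [Perm.sign_mul, Perm.sign_mul, Perm.sign_swap (by simpa using hij'),
    Perm.sign_swap (by simpa using hij')]
  simp only [mul_neg, mul_one, neg_neg]
  congr 1
  let f : Fin m → Fin (2 * m) := fun i => ⟨2 * i.val, by omega⟩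
  let g : Fin m → Fin (2 * m) := fun i => ⟨2 * i.val + 1, by omega⟩
  have hf : Function.Injective f := fun x y hxy => by
    simp only [f, Fin.mk.injEq] at hxy; omega
  have hg : Function.Injective g := fun x y hxy => by
    simp only [g, Fin.mk.injEq] at hxy; omega
  have hfg : ∀ x y, f x ≠ g y := fun x y => by
    simp only [f, g, ne_eq, Fin.mk.injEq]; omega
  have h1 : ∀ l, (swap (f i) (f j) * swap (g i) (g j)) (f l) = f (swap i j l) := fun l => by
    rw [Perm.mul_apply, swap_apply_of_ne_of_ne (hfg _ _) (hfg _ _), ← hf.map_swap]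
  have h2 : ∀ l, (swap (f i) (f j) * swap (g i) (g j)) (g l) = g (swap i j l) := fun l => by
    rw [Perm.mul_apply, ← hg.map_swap, swap_apply_of_ne_of_ne (hfg _ _).symm (hfg _ _).symm]
  refine Fintype.prod_equiv (swap i j) _ _ fun l => ?_
  exact congrArg₂ (fun x y => a (σ x).val (σ y).val) (h1 l) (h2 l)

theorem sum_pfTerm_fix {m : ℕ} {a : ℕ → ℕ → ℚ} (skew : ∀ i j, a j i = -a i j)
    (p : Fin (2 * (m + 1))) :
    ∑ σ : Perm (Fin (2 * (m + 1))), (if (σ p).val = 0 then pfTerm (m + 1) a σ else 0) =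
      ∑ σ : Perm (Fin (2 * (m + 1))), (if (σ ⟨0, by omega⟩).val = 0 then pfTerm (m + 1) a σ else 0) := by
  have step : ∀ (τ : Perm (Fin (2 * (m + 1)))) (q r : Fin (2 * (m + 1))), τ q = r →
      (∀ σ, pfTerm (m + 1) a (σ * τ) = pfTerm (m + 1) a σ) →
      ∑ σ : Perm (Fin (2 * (m + 1))), (if (σ q).val = 0 then pfTerm (m + 1) a σ else 0) =
      ∑ σ : Perm (Fin (2 * (m + 1))), (if (σ r).val = 0 then pfTerm (m + 1) a σ else 0) := by
    rintro τ q r rfl hτ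
    rw [← Equiv.sum_comp (Equiv.mulRight τ)]
    simp [hτ]
  have heven : ∀ i : Fin (m + 1),
      ∑ σ : Perm (Fin (2 * (m + 1))),
        (if (σ ⟨2 * i.val, by omega⟩).val = 0 then pfTerm (m + 1) a σ else 0) =
      ∑ σ : Perm (Fin (2 * (m + 1))), (if (σ ⟨0, by omega⟩).val = 0 then pfTerm (m + 1) a σ else 0) := by
    intro i
    by_cases hi : i = 0
    · subst hi; rfl
    · refine step _ _ _ ?_ (fun σ => pfTerm_mul_swap_pairs σ hi)
      have hfix : swap (⟨2 * i.val + 1, by omega⟩ : Fin (2 * (m + 1)))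
          ⟨2 * (0 : Fin (m + 1)).val + 1, by omega⟩ ⟨2 * i.val, by omega⟩ =
          ⟨2 * i.val, by omega⟩ := by
        apply swap_apply_of_ne_of_ne <;> simp only [ne_eq, Fin.mk.injEq] <;> omega
      rw [Perm.mul_apply, hfix, swap_apply_left]
      rfl
  have hodd : ∀ i : Fin (m + 1),
      ∑ σ : Perm (Fin (2 * (m + 1))),
        (if (σ ⟨2 * i.val + 1, by omega⟩).val = 0 then pfTerm (m + 1) a σ else 0) =
      ∑ σ : Perm (Fin (2 * (m + 1))),
        (if (σ ⟨0, by omega⟩).val = 0 then pfTerm (m + 1) a σ else 0) := fun i => by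
    rw [← heven i]
    exact step _ _ _ (swap_apply_right _ _) (fun σ => pfTerm_mul_swap_within skew σ i)
  rcases p with ⟨p, hp⟩
  obtain ⟨c, rfl | rfl⟩ := Nat.even_or_odd' p
  · exact heven ⟨c, by omega⟩
  · exact hodd ⟨c, by omega⟩

/-- Expansion of the Pfaffian along a first row whose only nonzero entry is the second one. -/
theorem pfSum_succ {m : ℕ} {a : ℕ → ℕ → ℚ} (skew : ∀ i j, a j i = -a i j)
    (hrow : ∀ j < 2 * (m + 1), j ≠ 1 → a 0 j = 0) :
    pfSum (m + 1) a = 2 * (m + 1) * a 0 1 * pfSum m (fun i j => a (i + 2) (j + 2)) := by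
  have h1 : pfSum (m + 1) a = ∑ p : Fin (2 * (m + 1)), ∑ σ : Perm (Fin (2 * (m + 1))),
      (if (σ p).val = 0 then pfTerm (m + 1) a σ else 0) := by
    rw [sum_comm]
    refine sum_congr rfl fun σ _ => ?_
    have : ∀ p, ((σ p).val = 0) = (p = σ.symm ⟨0, by omega⟩) := fun p => by
      rw [Equiv.eq_symm_apply, Fin.ext_iff]
    simp only [this, sum_ite_eq', mem_univ, if_true]
    rfl
  have h2 : ∑ σ : Perm (Fin (2 * (m + 1))), (if (σ ⟨0, by omega⟩).val = 0 then pfTerm (m + 1) a σ else 0) =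
      a 0 1 * pfSum m (fun i j => a (i + 2) (j + 2)) := by
    refine (sum_perm_fix_zero (k := 2 * m + 1) (fun σ => pfTerm (m + 1) a σ)).trans ?_
    have h3 : ∀ e : Perm (Fin (2 * m + 1)),
        pfTerm (m + 1) a (Perm.decomposeFin.symm (0, e)) = ((Perm.sign e : ℤ) : ℚ) *
          (a 0 ((e ⟨0, by omega⟩).val + 1) * ∏ i : Fin m, a ((e ⟨2 * i.val + 1, by omega⟩).val + 1)
            ((e ⟨2 * i.val + 2, by omega⟩).val + 1)) := by
      intro e
      unfold pfTerm
      rw [Fin.prod_univ_succ]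
      have hz : ∀ hlt, (Perm.decomposeFin.symm (0, e) : Perm (Fin (2 * m + 1 + 1))) ⟨0, hlt⟩ = 0 :=
        fun _ => Perm.decomposeFin_symm_apply_zero 0 e
      have hs : ∀ (x : ℕ) (hlt : x + 1 < 2 * m + 1 + 1),
          (Perm.decomposeFin.symm (0, e) : Perm (Fin (2 * m + 1 + 1))) ⟨x + 1, hlt⟩ =
            (e ⟨x, by omega⟩).succ := fun x hlt => by
        have := Perm.decomposeFin_symm_apply_succ e 0 ⟨x, by omega⟩
        simpa using this
      have hsign : Perm.sign (Perm.decomposeFin.symm (0, e) : Perm (Fin (2 * m + 1 + 1))) =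
          Perm.sign e := by
        simp
      refine congrArg₂ (· * ·) ?_ ?_
      · exact congrArg (fun u : ℤˣ => ((u : ℤ) : ℚ)) hsign
      · refine congrArg₂ (· * ·) ?_ ?_
        · exact congrArg₂ a (congrArg Fin.val (hz _)) (congrArg Fin.val (hs 0 _))
        · refine prod_congr rfl fun i _ => ?_
          exact congrArg₂ a (congrArg Fin.val (hs (2 * i.val + 1) (by omega)))
            (congrArg Fin.val (hs (2 * i.val + 2) (by omega)))
    simp only [h3]
    have h4 : ∀ e : Perm (Fin (2 * m + 1)), ((Perm.sign e : ℤ) : ℚ) *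
          (a 0 ((e ⟨0, by omega⟩).val + 1) * ∏ i : Fin m, a ((e ⟨2 * i.val + 1, by omega⟩).val + 1)
            ((e ⟨2 * i.val + 2, by omega⟩).val + 1)) =
        if (e ⟨0, by omega⟩).val = 0 then a 0 1 * (((Perm.sign e : ℤ) : ℚ) *
          ∏ i : Fin m, a ((e ⟨2 * i.val + 1, by omega⟩).val + 1)
            ((e ⟨2 * i.val + 2, by omega⟩).val + 1)) else 0 := by
      intro e
      split_ifs with he
      · rw [he]
        ring
      · rw [hrow _ (by omega) (by omega)]
        ring
    simp only [h4]
    rw [sum_perm_fix_zero (fun e => a 0 1 * (((Perm.sign e : ℤ) : ℚ) *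
          ∏ i : Fin m, a ((e ⟨2 * i.val + 1, by omega⟩).val + 1)
            ((e ⟨2 * i.val + 2, by omega⟩).val + 1))), ← mul_sum]
    congr 1
    unfold pfSum
    refine sum_congr rfl fun e _ => ?_
    have hs : ∀ (x : ℕ) (hlt : x + 1 < 2 * m + 1),
        (Perm.decomposeFin.symm (0, e) : Perm (Fin (2 * m + 1))) ⟨x + 1, hlt⟩ =
          (e ⟨x, by omega⟩).succ := fun x hlt => by
      have := Perm.decomposeFin_symm_apply_succ e 0 ⟨x, by omega⟩
      simpa using this
    refine congrArg₂ (· * ·) ?_ ?_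
    · simp
    · refine prod_congr rfl fun i _ => ?_
      rw [hs, hs (2 * i.val + 1)]
      simp
  rw [h1, sum_congr rfl fun p _ => sum_pfTerm_fix skew p, sum_const, card_univ, Fintype.card_fin,
    nsmul_eq_mul]
  rw [h2]
  push_cast
  ring

end Pfaffian

section Polynomials

open Finset

theorem qbinom_zero (x : ℚ) : qbinom x 0 = 1 := by simp [qbinom]

theorem qbinom_pascal (x : ℚ) (m : ℕ) :
    qbinom (x + 1) (m + 1) - qbinom x (m + 1) = qbinom x m := by
  unfold qbinom
  have h1 : ∏ j ∈ range (m + 1), (x + 1 - (j : ℚ)) = (∏ j ∈ range m, (x - (j : ℚ))) * (x + 1) := by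
    rw [prod_range_succ']
    congr 1
    · refine prod_congr rfl fun j _ => ?_
      push_cast; ring
    · simp
  have hm : (m.factorial : ℚ) ≠ 0 := by exact_mod_cast m.factorial_ne_zero
  have hm' : (m : ℚ) + 1 ≠ 0 := by positivity
  rw [h1, prod_range_succ, Nat.factorial_succ]
  push_cast
  field_simp
  ring

theorem qbinom_natCast_of_lt {k m : ℕ} (hkm : k < m) : qbinom (k : ℚ) m = 0 := by
  unfold qbinom
  rw [prod_eq_zero (mem_range.2 hkm) (sub_self _), zero_div]

theorem sum_Icc_int_sub (f : ℤ → ℚ) {a b : ℤ} (hab : a ≤ b) :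
    ∑ x ∈ Icc a (b - 1), (f (x + 1) - f x) = f b - f a := by
  induction b, hab using Int.leInduction with
  | base => simp
  | succ b hab ih =>
    have : Icc a (b + 1 - 1) = insert b (Icc a (b - 1)) := by
      ext x; simp only [mem_Icc, mem_insert]; omega
    rw [this, sum_insert (by simp), ih]
    ring

theorem sum_Icc_qbinom (m : ℕ) {a b : ℤ} (hab : a ≤ b) :
    ∑ x ∈ Icc a (b - 1), qbinom (x : ℚ) m = qbinom (b : ℚ) (m + 1) - qbinom (a : ℚ) (m + 1) := by
  rw [← sum_Icc_int_sub (fun x => qbinom (x : ℚ) (m + 1)) hab]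
  refine sum_congr rfl fun x _ => ?_
  rw [← qbinom_pascal]
  push_cast
  rfl

/-- The value of a bivariate polynomial at an integer point. -/
def evalInt (P : MvPolynomial (Fin 2) ℚ) (x y : ℤ) : ℚ :=
  MvPolynomial.eval ![(x : ℚ), (y : ℚ)] P

theorem exists_univariate (P : MvPolynomial (Fin 2) ℚ) (p q : Polynomial ℚ) :
    ∃ r : Polynomial ℚ, ∀ x : ℚ, r.eval x = MvPolynomial.eval ![p.eval x, q.eval x] P := by
  refine ⟨MvPolynomial.aeval ![p, q] P, fun x => ?_⟩
  have h1 := MvPolynomial.map_aeval (![p, q]) (Polynomial.evalRingHom x) P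
  rw [Polynomial.coe_evalRingHom] at h1
  rw [h1, MvPolynomial.eval, MvPolynomial.eval₂Hom_congr _ _ rfl]
  · ext; simp
  · funext i; fin_cases i <;> simp

theorem polynomial_eq_of_large {p q : Polynomial ℚ} (h : ℤ)
    (hpq : ∀ x : ℤ, h ≤ x → p.eval (x : ℚ) = q.eval (x : ℚ)) : p = q := by
  refine Polynomial.eq_of_infinite_eval_eq p q ?_
  refine Set.Infinite.mono ?_ ((Set.Ici_infinite h).image
    (Int.cast_injective (α := ℚ)).injOn)
  rintro _ ⟨x, hx, rfl⟩
  exact hpq x hx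

variable {gt : ℕ → MvPolynomial (Fin 2) ℚ}

theorem gt_diag (hgt : gtChar gt) {h : ℕ} (hh : 1 ≤ h) (x : ℤ) : evalInt (gt h) x x = 0 := by
  obtain ⟨r, hr⟩ := exists_univariate (gt h) Polynomial.X Polynomial.X
  have : r = 0 := polynomial_eq_of_large h fun x hx => by
    have := hgt.2 h hh x x hx
    rw [hr, Polynomial.eval_X, this, Polynomial.eval_zero]
    exact sum_eq_zero fun p _ => by ring
  have h2 := hr x
  rw [this, Polynomial.eval_zero, Polynomial.eval_X] at h2
  exact h2.symm

theorem gt_mixed_difference_of_le (hgt : gtChar gt) (h : ℕ) {x : ℤ} (y : ℤ) (hx : (h : ℤ) + 1 ≤ x) :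
    evalInt (gt (h + 1)) (x + 1) (y + 1) - evalInt (gt (h + 1)) (x + 1) y -
      evalInt (gt (h + 1)) x (y + 1) + evalInt (gt (h + 1)) x y = evalInt (gt h) x y := by
  have hval : ∀ x y : ℤ, ((h : ℤ) + 1 ≤ x) → evalInt (gt (h + 1)) x y = _ := fun x y hx =>
    hgt.2 (h + 1) (by omega) x y (by push_cast; exact hx)
  rw [hval _ _ hx, hval _ _ hx, hval _ _ (by omega), hval _ _ (by omega)]
  rcases h with _ | h
  · have q1 : ∀ z : ℚ, qbinom z 1 = z := fun z => by simp [qbinom]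
    have hc : ∀ x y : ℤ, 1 ≤ x → ∑ p ∈ Icc (1 : ℤ) (x - 1), (((x : ℚ) - p) * (y - p + 1 - 2) -
        (x - p + 1 - 2) * (y - p)) = (x - 1) * (y - x) := by
      intro x y hx
      have : ∀ p : ℤ, (((x : ℚ) - p) * (y - p + 1 - 2) - (x - p + 1 - 2) * (y - p)) = y - x :=
        fun p => by ring
      simp only [this, sum_const, Int.card_Icc, nsmul_eq_mul]
      congr 1
      have : ((x - 1 + 1 - 1).toNat : ℤ) = x - 1 := by rw [Int.toNat_of_nonneg] <;> omega
      exact_mod_cast this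
    simp only [Nat.cast_zero, zero_add] at hx
    have e1 := hc x y hx
    have e2 := hc x (y + 1) hx
    have e3 := hc (x + 1) y (by omega)
    have e4 := hc (x + 1) (y + 1) (by omega)
    simp only [zero_add, q1, Nat.cast_one, add_sub_cancel_right] at e3 e4 ⊢
    rw [e1, e2, e3, e4, evalInt, hgt.1, map_one]
    push_cast
    ring
  · have hx' : evalInt (gt (h + 1)) x y = _ :=
      hgt.2 (h + 1) (by omega) x y (by push_cast at hx ⊢; omega)
    rw [hx']
    set c : ℤ := ((h + 1 + 1 : ℕ) : ℤ) with hcdef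
    have extend : ∀ f : ℤ → ℚ, f x = 0 →
        ∑ p ∈ Icc c (x - 1), f p = ∑ p ∈ Icc c x, f p := by
      intro f hf
      have : Icc c x = insert x (Icc c (x - 1)) := by
        ext z; simp only [mem_Icc, mem_insert]; push_cast at hcdef hx; omega
      rw [this, sum_insert (by simp), hf, zero_add]
    have z1 : qbinom ((x : ℚ) - (x : ℤ) + ((h + 1 + 1 : ℕ) : ℚ) - 1) (h + 1 + 1) = 0 := by
      rw [← qbinom_natCast_of_lt (show h + 1 < h + 1 + 1 by omega)]
      congr 1; push_cast; ring
    have z2 : qbinom ((x : ℚ) - (x : ℤ) + ((h + 1 + 1 : ℕ) : ℚ) - 2) (h + 1 + 1) = 0 := by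
      rw [← qbinom_natCast_of_lt (show h < h + 1 + 1 by omega)]
      congr 1; push_cast; ring
    have shift : ∀ f : ℤ → ℚ, ∑ p ∈ Icc ((h + 1 : ℕ) : ℤ) (x - 1), f p =
        ∑ p ∈ Icc c x, f (p - 1) := by
      intro f
      refine sum_nbij' (fun p => p + 1) (fun p => p - 1) ?_ ?_ ?_ ?_ ?_
      · intro p hp; simp only [mem_Icc] at hp ⊢; push_cast at hcdef hp; omega
      · intro p hp; simp only [mem_Icc] at hp ⊢; push_cast at hcdef ⊢; omega
      all_goals intro p _; simp
    rw [extend _ (by rw [z1, z2]; ring), extend _ (by rw [z1, z2]; ring), shift,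
      show x + 1 - 1 = x by ring, ← sum_sub_distrib, ← sum_sub_distrib, ← sum_add_distrib]
    refine sum_congr rfl fun p _ => ?_
    have pas : ∀ u v w : ℚ, v = u + 1 → w = u →
        qbinom v (h + 1 + 1) = qbinom u (h + 1 + 1) + qbinom w (h + 1) := by
      rintro u v w rfl rfl
      linarith [qbinom_pascal w (h + 1)]
    push_cast
    rw [pas (x - p + (h + 1 + 1) - 1) (x + 1 - p + (h + 1 + 1) - 1)
        (x - (p - 1) + (h + 1) - 1) (by ring) (by ring),
      pas (y - p + (h + 1 + 1) - 1) (y + 1 - p + (h + 1 + 1) - 1)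
        (y - (p - 1) + (h + 1) - 1) (by ring) (by ring),
      pas (x - p + (h + 1 + 1) - 2) (x + 1 - p + (h + 1 + 1) - 2)
        (x - (p - 1) + (h + 1) - 2) (by ring) (by ring),
      pas (y - p + (h + 1 + 1) - 2) (y + 1 - p + (h + 1 + 1) - 2)
        (y - (p - 1) + (h + 1) - 2) (by ring) (by ring)]
    ring

/-- The mixed forward difference of `gt (h + 1)` is `gt h`. -/
theorem gt_mixed_difference (hgt : gtChar gt) (h : ℕ) (x y : ℤ) :
    evalInt (gt (h + 1)) (x + 1) (y + 1) - evalInt (gt (h + 1)) (x + 1) y -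
      evalInt (gt (h + 1)) x (y + 1) + evalInt (gt (h + 1)) x y = evalInt (gt h) x y := by
  obtain ⟨r1, hr1⟩ := exists_univariate (gt (h + 1)) (Polynomial.X + 1) (Polynomial.C ((y : ℚ) + 1))
  obtain ⟨r2, hr2⟩ := exists_univariate (gt (h + 1)) (Polynomial.X + 1) (Polynomial.C (y : ℚ))
  obtain ⟨r3, hr3⟩ := exists_univariate (gt (h + 1)) Polynomial.X (Polynomial.C ((y : ℚ) + 1))
  obtain ⟨r4, hr4⟩ := exists_univariate (gt (h + 1)) Polynomial.X (Polynomial.C (y : ℚ))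
  obtain ⟨r5, hr5⟩ := exists_univariate (gt h) Polynomial.X (Polynomial.C (y : ℚ))
  have hall : ∀ x : ℤ, (r1 - r2 - r3 + r4).eval (x : ℚ) =
      evalInt (gt (h + 1)) (x + 1) (y + 1) - evalInt (gt (h + 1)) (x + 1) y -
        evalInt (gt (h + 1)) x (y + 1) + evalInt (gt (h + 1)) x y := fun x => by
    simp [hr1, hr2, hr3, hr4, evalInt]
  have hr : ∀ x : ℤ, r5.eval (x : ℚ) = evalInt (gt h) x y := fun x => by
    simp [hr5, evalInt]
  have heq : r1 - r2 - r3 + r4 = r5 := polynomial_eq_of_large ((h : ℤ) + 1) fun x hx => by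
    rw [hall, hr, gt_mixed_difference_of_le hgt h y hx]
  rw [← hall, ← hr, heq]

theorem sum_sum_gt (hgt : gtChar gt) (h : ℕ) {a b c d : ℤ} (hab : a ≤ b) (hcd : c ≤ d) :
    ∑ x ∈ Icc a (b - 1), ∑ y ∈ Icc c (d - 1), evalInt (gt h) x y =
      evalInt (gt (h + 1)) b d - evalInt (gt (h + 1)) b c -
        evalInt (gt (h + 1)) a d + evalInt (gt (h + 1)) a c := by
  have inner : ∀ x : ℤ, ∑ y ∈ Icc c (d - 1), evalInt (gt h) x y =
      (evalInt (gt (h + 1)) (x + 1) d - evalInt (gt (h + 1)) (x + 1) c) -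
        (evalInt (gt (h + 1)) x d - evalInt (gt (h + 1)) x c) := by
    intro x
    rw [← sum_Icc_int_sub _ hcd, ← sum_Icc_int_sub _ hcd, ← sum_sub_distrib]
    refine sum_congr rfl fun y _ => ?_
    rw [← gt_mixed_difference hgt]
    ring
  simp only [inner]
  rw [sum_Icc_int_sub (fun x => evalInt (gt (h + 1)) x d - evalInt (gt (h + 1)) x c) hab]
  ring

end Polynomials

section Reduction

open Finset Equiv

/-- Rows `1, …, n - 1` are replaced by their backward differences. -/
def rowDiff (n : ℕ) (f : ℕ → ℚ) (i : ℕ) : ℚ :=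
  if 1 ≤ i ∧ i < n then f i - f (i - 1) else f i

theorem pfSum_rowDiff {m : ℕ} (n : ℕ) (a : ℕ → ℕ → ℚ) :
    pfSum m (fun i j => rowDiff n (fun p => rowDiff n (fun q => a p q) j) i) = pfSum m a := by
  let M : Matrix (Fin (2 * m)) (Fin (2 * m)) ℚ := fun i p =>
    (if p = i then 1 else 0) - (if (1 ≤ i.val ∧ i.val < n) ∧ p.val + 1 = i.val then 1 else 0)
  have hM : ∀ (i : Fin (2 * m)) (f : ℕ → ℚ), ∑ p, M i p * f p = rowDiff n f i := by
    intro i f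
    simp only [M, sub_mul, sum_sub_distrib, ite_mul, one_mul, zero_mul, sum_ite_eq', mem_univ,
      if_true, rowDiff]
    split_ifs with hi
    · congr 1
      rw [sum_eq_single (⟨i.val - 1, by omega⟩ : Fin (2 * m))]
      · rw [if_pos ⟨hi, by simp only; omega⟩]
      · intro p _ hp
        rw [if_neg]
        rintro ⟨-, h⟩
        exact hp (Fin.ext (by simp only; omega))
      · simp
    · simp [hi]
  have hdet : M.det = 1 := by
    rw [Matrix.det_of_isLowerTriangular]
    · refine prod_eq_one fun i _ => ?_
      simp [M]
    · intro i j hij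
      have hij' : i < j := hij
      simp only [M]
      rw [if_neg (by omega), if_neg (by omega), sub_zero]
  rw [pfSum_conj M a, hdet, one_mul]
  intro i j
  rw [← hM]
  refine sum_congr rfl fun p _ => ?_
  rw [← hM, mul_sum]
  exact sum_congr rfl fun q _ => by ring

/-- Expansion of the Pfaffian when the only nonzero entry of the last row is its first one. -/
theorem pfSum_last {m : ℕ} {a : ℕ → ℕ → ℚ} (skew : ∀ i j, a j i = -a i j)
    (hrow : ∀ j < 2 * (m + 1), j ≠ 0 → a (2 * m + 1) j = 0) :
    pfSum (m + 1) a = 2 * (m + 1) * a 0 (2 * m + 1) * pfSum m (fun i j => a (i + 1) (j + 1)) := by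
  let ρ : ℕ → ℕ := fun i => if i = 0 then 2 * m + 1 else i - 1
  have hρ : ∀ i : Fin (2 * m + 1 + 1), ρ i = ((finRotate (2 * m + 1 + 1)).symm i).val := by
    intro i
    obtain ⟨j, rfl⟩ := (finRotate (2 * m + 1 + 1)).surjective i
    rw [symm_apply_apply, coe_finRotate]
    by_cases hj : j = Fin.last (2 * m + 1)
    · simp [hj, ρ]
    · simp [hj, ρ]
  have h1 := pfSum_perm (m := m + 1) (finRotate (2 * m + 1 + 1)).symm a
    (fun i j => a (ρ i) (ρ j)) (fun i j => congrArg₂ a (hρ i) (hρ j))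
  have hsign : ((Perm.sign ((finRotate (2 * m + 1 + 1)).symm) : ℤ) : ℚ) = -1 := by
    rw [Perm.sign_symm, sign_finRotate]
    simp [pow_succ, pow_mul]
  have h2 := pfSum_succ (m := m) (a := fun i j => a (ρ i) (ρ j)) (fun i j => skew _ _) (by
    intro j hj hj1
    by_cases hj0 : j = 0
    · subst hj0
      have := skew (2 * m + 1) (2 * m + 1)
      simp only [ρ, if_true]
      linarith
    · simp only [ρ, hj0, if_true, if_false]
      exact hrow _ (by omega) (by omega))
  have h3 : pfSum (m + 1) a = -pfSum (m + 1) (fun i j => a (ρ i) (ρ j)) := by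
    rw [h1]
    erw [hsign]
    ring
  rw [h3, h2]
  simp only [ρ, if_true, one_ne_zero, if_false, Nat.add_eq_zero_iff, OfNat.ofNat_ne_zero, and_false,
    Nat.sub_self]
  rw [skew 0 (2 * m + 1)]
  simp only [show ∀ i, i + 2 - 1 = i + 1 from fun i => rfl]
  ring

/-- The skew-symmetric array built from a kernel `g` and columns `c` on `n` variables `x`. -/
def borderedArray (n : ℕ) (g : ℤ → ℤ → ℚ) (c : ℤ → ℕ → ℚ) (x : ℕ → ℤ) (i j : ℕ) : ℚ :=
  if i < n then
    if j < n then (if i < j then g (x i) (x j) else if j < i then -g (x j) (x i) else 0)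
    else c (x i) (j - n)
  else if j < n then -c (x j) (i - n) else 0

theorem borderedArray_skew (n : ℕ) (g : ℤ → ℤ → ℚ) (c : ℤ → ℕ → ℚ) (x : ℕ → ℤ) (i j : ℕ) :
    borderedArray n g c x j i = -borderedArray n g c x i j := by
  unfold borderedArray
  split_ifs <;> first | omega | simp

variable {gt : ℕ → MvPolynomial (Fin 2) ℚ}

theorem rowDiff_borderedArray (hgt : gtChar gt) (h n : ℕ) (K : ℕ → ℤ)
    (hK : ∀ i < n, K i ≤ K (i + 1)) (i j : ℕ) (hi : i < n + h) (hj : j < n + h) :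
    rowDiff (n + 1) (fun p => rowDiff (n + 1) (fun q => borderedArray (n + 1) (evalInt (gt (h + 1)))
        (fun x b => qbinom x (h - b)) K p q) (j + 1)) (i + 1) =
      ∑ x ∈ (if i < n then Icc (K i) (K (i + 1) - 1) else {0}),
        ∑ y ∈ (if j < n then Icc (K j) (K (j + 1) - 1) else {0}),
          borderedArray n (evalInt (gt h)) (fun x b => qbinom x (h - 1 - b))
            (fun p => if p = i then x else y) i j := by
  have hgen : ∀ i j, i < n → j < n → i < j →
      borderedArray (n + 1) (evalInt (gt (h + 1))) (fun x b => qbinom x (h - b)) K (i + 1) (j + 1) -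
      borderedArray (n + 1) (evalInt (gt (h + 1))) (fun x b => qbinom x (h - b)) K (i + 1) j -
      (borderedArray (n + 1) (evalInt (gt (h + 1))) (fun x b => qbinom x (h - b)) K i (j + 1) -
      borderedArray (n + 1) (evalInt (gt (h + 1))) (fun x b => qbinom x (h - b)) K i j) =
      ∑ x ∈ Icc (K i) (K (i + 1) - 1), ∑ y ∈ Icc (K j) (K (j + 1) - 1), evalInt (gt h) x y := by
    intro i j hi hj hij
    rw [sum_sum_gt hgt h (hK i hi) (hK j hj)]
    have hdiag : borderedArray (n + 1) (evalInt (gt (h + 1))) (fun x b => qbinom x (h - b)) K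
        (i + 1) j = evalInt (gt (h + 1)) (K (i + 1)) (K j) := by
      rcases Nat.lt_or_ge (i + 1) j with h1 | h1
      · simp [borderedArray, h1, show i < n by omega, show j < n + 1 by omega]
      · obtain rfl : i + 1 = j := by omega
        simp [borderedArray, gt_diag hgt (show 1 ≤ h + 1 by omega), hi]
    rw [hdiag]
    simp only [borderedArray, show i + 1 < n + 1 by omega, show j + 1 < n + 1 by omega,
      show i < n + 1 by omega, show j < n + 1 by omega, show i + 1 < j + 1 by omega,
      show i < j + 1 by omega, hij, if_true]
    ring
  have hcol : ∀ i j, i < n → n ≤ j → j < n + h →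
      borderedArray (n + 1) (evalInt (gt (h + 1))) (fun x b => qbinom x (h - b)) K (i + 1) (j + 1) -
      borderedArray (n + 1) (evalInt (gt (h + 1))) (fun x b => qbinom x (h - b)) K i (j + 1) =
      ∑ x ∈ Icc (K i) (K (i + 1) - 1), qbinom x (h - 1 - (j - n)) := by
    intro i j hi hj hj'
    rw [sum_Icc_qbinom _ (hK i hi)]
    simp only [borderedArray, show i + 1 < n + 1 by omega, show ¬ (j + 1 < n + 1) by omega,
      show i < n + 1 by omega, if_true, if_false]
    rw [show h - 1 - (j - n) + 1 = h - (j + 1 - (n + 1)) by omega]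
  have hskew := borderedArray_skew (n + 1) (evalInt (gt (h + 1))) (fun x b => qbinom x (h - b)) K
  have hzero : ∀ i j, ¬ i < n → ¬ j < n → borderedArray (n + 1) (evalInt (gt (h + 1)))
      (fun x b => qbinom x (h - b)) K (i + 1) (j + 1) = 0 := by
    intro i j hi hj
    simp [borderedArray, hi, hj]
  generalize borderedArray (n + 1) (evalInt (gt (h + 1))) (fun x b => qbinom x (h - b)) K = C
    at hgen hcol hskew hzero ⊢
  unfold rowDiff
  by_cases hin : i < n <;> by_cases hjn : j < n
  · simp only [show 1 ≤ i + 1 ∧ i + 1 < n + 1 by omega, show 1 ≤ j + 1 ∧ j + 1 < n + 1 by omega,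
      if_true, hin, hjn, Nat.add_sub_cancel, and_self]
    rcases lt_trichotomy i j with hij | rfl | hij
    · have := hgen i j hin hjn hij
      simp only [borderedArray, hin, hjn, hij, if_true, hij.ne', if_false]
      exact this
    · simp only [borderedArray, hin, lt_irrefl, if_true, if_false, sum_const_zero]
      have h1 := hskew i i
      have h2 := hskew (i + 1) (i + 1)
      have h3 := hskew i (i + 1)
      linarith
    · have := hgen j i hjn hin hij
      simp only [borderedArray, hin, hjn, hij, if_true, hij.ne, if_false, hij.not_gt]
      rw [sum_comm]
      simp only [sum_neg_distrib]
      rw [← this, hskew (j + 1) (i + 1), hskew j i, hskew (j + 1) i, hskew j (i + 1)]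
      ring
  · simp only [show 1 ≤ i + 1 ∧ i + 1 < n + 1 by omega, show ¬ (j + 1 < n + 1) by omega,
      if_true, hin, hjn, Nat.add_sub_cancel, and_self, and_false, if_false, sum_singleton]
    simp only [borderedArray, hin, hjn, if_true, if_false]
    exact hcol i j hin (by omega) hj
  · simp only [show 1 ≤ j + 1 ∧ j + 1 < n + 1 by omega, show ¬ (i + 1 < n + 1) by omega,
      if_true, hin, hjn, Nat.add_sub_cancel, and_self, and_false, if_false, sum_singleton]
    simp only [borderedArray, hin, hjn, if_true, if_false, sum_neg_distrib,
      show j ≠ i by omega]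
    rw [← hcol j i hjn (by omega) hi, hskew (j + 1) (i + 1), hskew j (i + 1)]
    ring
  · simp only [show ¬ (j + 1 < n + 1) by omega, show ¬ (i + 1 < n + 1) by omega,
      hin, hjn, and_false, if_false, sum_singleton]
    simp [borderedArray, hin, hjn, hzero]

/-- The summation formula, in terms of `pfSum` and natural-number indices. -/
theorem pfSum_borderedArray_succ (hgt : gtChar gt) (h n m : ℕ) (hm : n + h = 2 * m) (K : ℕ → ℤ)
    (hK : ∀ i < n, K i ≤ K (i + 1)) :
    pfSum (m + 1) (borderedArray (n + 1) (evalInt (gt (h + 1))) (fun x b => qbinom x (h - b)) K) =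
      2 * (m + 1) * ∑ l ∈ Fintype.piFinset
          (fun i : Fin n => Icc (K i) (K (i + 1) - 1)),
        pfSum m (borderedArray n (evalInt (gt h)) (fun x b => qbinom x (h - 1 - b))
          (fun i => if hi : i < n then l ⟨i, hi⟩ else 0)) := by
  rw [← pfSum_rowDiff (n + 1)]
  have hsk := borderedArray_skew (n + 1) (evalInt (gt (h + 1))) (fun x b => qbinom x (h - b)) K
  rw [pfSum_last]
  · have hcorner : rowDiff (n + 1) (fun p => rowDiff (n + 1) (fun q =>
        borderedArray (n + 1) (evalInt (gt (h + 1))) (fun x b => qbinom x (h - b)) K p q)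
          (2 * m + 1)) 0 = 1 := by
      simp [rowDiff, borderedArray, show ¬ (2 * m < n) by omega,
        show h - (2 * m - n) = 0 by omega, qbinom_zero]
    rw [hcorner, mul_one]
    congr 1
    let s : ℕ → Finset ℤ := fun i => if i < n then Icc (K i) (K (i + 1) - 1) else {0}
    let B : (Fin (2 * m) → ℤ) → ℕ → ℕ → ℚ := fun L =>
      borderedArray n (evalInt (gt h)) (fun x b => qbinom x (h - 1 - b))
        (fun i => if hi : i < 2 * m then L ⟨i, hi⟩ else 0)
    have hsum := sum_pfSum (m := m) s (fun i j x y =>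
      borderedArray n (evalInt (gt h)) (fun x b => qbinom x (h - 1 - b))
            (fun p => if p = i then x else y) i j) B (by
        intro L i j
        by_cases hij : i.val = j.val
        · simp [B, borderedArray, Fin.ext hij]
        · simp [B, borderedArray, Ne.symm hij])
    rw [pfSum_congr (fun i hi j hj =>
      rowDiff_borderedArray hgt h n K hK i j (by omega) (by omega))]
    refine hsum.symm.trans ?_
    symm
    refine sum_nbij' (fun l i => if hi : i.val < n then l ⟨i.val, hi⟩ else 0)
      (fun L i => L ⟨i.val, by omega⟩) ?_ ?_ ?_ ?_ ?_
    · intro l hl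
      simp only [Fintype.mem_piFinset] at hl ⊢
      intro i
      by_cases hi : i.val < n
      · simpa [s, hi] using hl ⟨i.val, hi⟩
      · simp [s, hi]
    · intro L hL
      simp only [Fintype.mem_piFinset] at hL ⊢
      intro i
      simpa [s] using hL ⟨i.val, by omega⟩
    · intro l _
      funext i
      simp
    · intro L hL
      simp only [Fintype.mem_piFinset] at hL
      funext i
      by_cases hi : i.val < n
      · simp [hi]
      · have := hL i
        simp only [s, hi, if_false, mem_singleton] at this
        simp [hi, this]
    · intro l _
      simp only [B]
      congr 2
      funext i
      by_cases hi : i < n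
      · simp [hi, show i < 2 * m by omega]
      · simp [hi]
  · intro i j
    simp only [rowDiff]
    split_ifs <;> (simp only [hsk _ j, hsk _ (j - 1)]; try ring)
  · intro j hj hj0
    simp only [rowDiff, borderedArray, show ¬ (2 * m + 1 < n + 1) by omega, and_false, if_false]
    simp only [show h - (2 * m + 1 - (n + 1)) = 0 by omega, qbinom_zero]
    split_ifs <;> first | omega | simp

end Reduction

/-- For positive integers `h < n` with `n + h` even and weakly increasing
integers `k_1 ≤ … ≤ k_n`, the sum over all tuples `(l_1,…,l_{n-1})` with
`k_i ≤ l_i ≤ k_{i+1} - 1` of the Pfaffian of the order `n+h-2` array built from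
`gt_{h-1}` and binomials in the `l`'s equals the Pfaffian of the order `n+h` array built
from `gt_h` and binomials in the `k`'s. -/
theorem statement3 (h n : ℕ) (hh : 1 ≤ h) (hn : h < n) (heven : Even (n + h))
    (k : Fin n → ℤ) (hk : Monotone k)
    (gt : ℕ → MvPolynomial (Fin 2) ℚ) (hgt : gtChar gt) :
    (∑ l ∈ Fintype.piFinset (fun i : Fin (n-1) =>
        Finset.Icc (k ⟨i.val, by have := i.isLt; omega⟩)
          (k ⟨i.val + 1, by have := i.isLt; omega⟩ - 1)),
      pfUpper ((n-1) + (h-1)) (fun a b =>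
        if ha : (a : ℕ) < n - 1 then
          if hb : (b : ℕ) < n - 1 then
            MvPolynomial.eval
              ![((l ⟨(a : ℕ), ha⟩ : ℤ) : ℚ), ((l ⟨(b : ℕ), hb⟩ : ℤ) : ℚ)] (gt (h-1))
          else qbinom ((l ⟨(a : ℕ), ha⟩ : ℤ) : ℚ) ((h-1) - 1 - ((b : ℕ) - (n-1)))
        else 0)) =
      pfUpper (n + h) (fun a b =>
        if ha : (a : ℕ) < n then
          if hb : (b : ℕ) < n then
            MvPolynomial.eval
              ![((k ⟨(a : ℕ), ha⟩ : ℤ) : ℚ), ((k ⟨(b : ℕ), hb⟩ : ℤ) : ℚ)] (gt h)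
          else qbinom ((k ⟨(a : ℕ), ha⟩ : ℤ) : ℚ) (h - 1 - ((b : ℕ) - n))
        else 0) := by
  obtain ⟨h, rfl⟩ : ∃ h', h = h' + 1 := ⟨h - 1, by omega⟩
  obtain ⟨n, rfl⟩ : ∃ n', n = n' + 1 := ⟨n - 1, by omega⟩
  obtain ⟨m, hm⟩ : ∃ m, n + h = 2 * m := by
    obtain ⟨c, hc⟩ := heven
    exact ⟨c - 1, by omega⟩
  let K : ℕ → ℤ := fun i => if hi : i < n + 1 then k ⟨i, hi⟩ else 0
  have hKk : ∀ (i : ℕ) (hi : i < n + 1), K i = k ⟨i, hi⟩ := fun i hi => dif_pos hi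
  have hK : ∀ i < n, K i ≤ K (i + 1) := fun i hi => by
    rw [hKk i (by omega), hKk (i + 1) (by omega)]
    exact hk (by simp)
  have hmain := pfSum_borderedArray_succ hgt h n m hm K hK
  rw [pfUpper_eq_pfSum (m := m + 1) (by omega) _
    (borderedArray (n + 1) (evalInt (gt (h + 1))) (fun x b => qbinom x (h - b)) K)
    (borderedArray_skew _ _ _ K) (by
    intro i j hij
    have hij' : i.val < j.val := hij
    by_cases hi : i.val < n + 1 <;> by_cases hj : j.val < n + 1
    · simp only [hi, hj, borderedArray, dif_pos, if_true, hij', hKk, evalInt]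
    · simp only [hi, hj, borderedArray, dif_pos, if_true, if_false, hKk, dif_neg, not_false_eq_true,
        Nat.add_sub_cancel]
    · omega
    · simp only [hi, hj, borderedArray, if_false, dif_neg, not_false_eq_true])]
  rw [hmain]
  have hfac : ((2 : ℚ) ^ (m + 1) * ((m + 1).factorial : ℚ))⁻¹ * (2 * (m + 1)) =
      (2 ^ m * (m.factorial : ℚ))⁻¹ := by
    have : (m.factorial : ℚ) ≠ 0 := by exact_mod_cast m.factorial_ne_zero
    have : (m : ℚ) + 1 ≠ 0 := by positivity
    rw [Nat.factorial_succ]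
    push_cast
    field_simp
    ring
  rw [← mul_assoc, hfac, Finset.mul_sum]
  have hset : ∀ i : Fin n, Finset.Icc (K i) (K (i + 1) - 1) =
      Finset.Icc (k ⟨i.val, by omega⟩) (k ⟨i.val + 1, by omega⟩ - 1) := fun i => by
    rw [hKk i (by omega), hKk (i + 1) (by omega)]
  simp only [hset]
  refine Finset.sum_congr rfl fun l _ => ?_
  refine pfUpper_eq_pfSum (m := m) hm _ _ (borderedArray_skew _ _ _ _) ?_
  intro i j hij
  have hij' : i.val < j.val := hij
  simp only [Nat.add_sub_cancel]
  by_cases hi : i.val < n <;> by_cases hj : j.val < n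
  · simp only [hi, hj, borderedArray, dif_pos, if_true, hij', evalInt]
  · simp only [hi, hj, borderedArray, dif_pos, if_true, if_false, dif_neg, not_false_eq_true]
  · omega
  · simp only [hi, hj, borderedArray, if_false, dif_neg, not_false_eq_true]
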